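/- arXiv:1402.3061 — 4 statements merged into one kernel-verified Lean document; each statement's English description precedes it below -/
import Mathlib

section
/- For every t > 0, every Schwartz function f on ℝⁿ, every index j ∈ {1,…,n} and every z ∈ ℂⁿ: W_t(2^{−1/2}(x_j f − t ∂_{x_j} f))(z) = z_j · (W_t f)(z). In other words, the Segal–Bargmann transform intertwines the creation operator A_j* := 2^{−1/2}(x_j − t∂_{x_j}) with multiplication by z_j. -/
open MeasureTheory Complex SchwartzMap

/-- The Segal–Bargmann transform of `f : ℝⁿ → ℂ`. -/
noncomputable def segalBargmann (n : ℕ) (t : ℝ) (f : (Fin n → ℝ) → ℂ)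
    (z : Fin n → ℂ) : ℂ :=
  (((Real.pi * t) ^ (-(n : ℝ) / 4) : ℝ) : ℂ) *
    ∫ x : Fin n → ℝ,
      Complex.exp ((-(∑ k, z k ^ 2) + 2 * (Real.sqrt 2 : ℂ) * (∑ k, (x k : ℂ) * z k)
        - ∑ k, (x k : ℂ) ^ 2) / (2 * (t : ℂ))) * f x

/-- The integral kernel of the Segal–Bargmann transform. -/
noncomputable def segalBargmannKernel {n : ℕ} (t : ℝ) (z : Fin n → ℂ) (x : Fin n → ℝ) : ℂ :=
  Complex.exp ((-(∑ k, z k ^ 2) + 2 * (Real.sqrt 2 : ℂ) * (∑ k, (x k : ℂ) * z k)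
    - ∑ k, (x k : ℂ) ^ 2) / (2 * (t : ℂ)))

theorem segalBargmann_eq_integral_kernel {n : ℕ} (t : ℝ) (f : (Fin n → ℝ) → ℂ)
    (z : Fin n → ℂ) :
    segalBargmann n t f z = (((Real.pi * t) ^ (-(n : ℝ) / 4) : ℝ) : ℂ) *
      ∫ x, segalBargmannKernel t z x * f x :=
  rfl

theorem continuous_segalBargmannKernel {n : ℕ} (t : ℝ) (z : Fin n → ℂ) :
    Continuous (segalBargmannKernel t z) := by
  unfold segalBargmannKernel
  fun_prop

theorem norm_segalBargmannKernel_le {n : ℕ} {t : ℝ} (ht : 0 < t) (z : Fin n → ℂ)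
    (x : Fin n → ℝ) :
    ‖segalBargmannKernel t z x‖ ≤
      Real.exp ((-(∑ k, (z k ^ 2).re) + 2 * ∑ k, (z k).re ^ 2) / (2 * t)) := by
  have hre : ((-(∑ k, z k ^ 2) + 2 * (Real.sqrt 2 : ℂ) * (∑ k, (x k : ℂ) * z k)
      - ∑ k, (x k : ℂ) ^ 2) / (2 * (t : ℂ))).re =
      (-(∑ k, (z k ^ 2).re) + 2 * Real.sqrt 2 * (∑ k, x k * (z k).re)
        - ∑ k, x k ^ 2) / (2 * t) := by
    have h2 : (2 * (t : ℂ)) = ((2 * t : ℝ) : ℂ) := by push_cast; rfl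
    have h3 : (2 * (Real.sqrt 2 : ℂ)) = ((2 * Real.sqrt 2 : ℝ) : ℂ) := by push_cast; rfl
    rw [h2, h3, Complex.div_ofReal_re, Complex.sub_re, Complex.add_re, Complex.neg_re,
      Complex.re_ofReal_mul]
    simp only [Complex.re_sum, Complex.re_ofReal_mul, ← Complex.ofReal_pow, Complex.ofReal_re]
  rw [segalBargmannKernel, Complex.norm_exp, hre]
  gcongr
  rw [add_sub_assoc]
  gcongr
  rw [Finset.mul_sum, Finset.mul_sum, ← Finset.sum_sub_distrib]
  refine Finset.sum_le_sum fun k _ => ?_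
  nlinarith [sq_nonneg (x k - Real.sqrt 2 * (z k).re), Real.sq_sqrt (zero_le_two (α := ℝ))]

theorem hasLineDerivAt_segalBargmannKernel {n : ℕ} {t : ℝ} (ht : 0 < t) (z : Fin n → ℂ)
    (j : Fin n) (x : Fin n → ℝ) :
    HasLineDerivAt ℝ (segalBargmannKernel t z)
      (segalBargmannKernel t z x * (((Real.sqrt 2 : ℂ) * z j - x j) / t)) x
      (Pi.single j 1) := by
  have ht' : (t : ℂ) ≠ 0 := by exact_mod_cast ht.ne'
  have hx (k : Fin n) : HasDerivAt
      (fun s : ℝ => (((x + s • (Pi.single j 1 : Fin n → ℝ)) k : ℝ) : ℂ))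
      ((Pi.single j 1 : Fin n → ℂ) k) 0 := by
    have h : HasDerivAt (fun s : ℝ => x k + s * (Pi.single j 1 : Fin n → ℝ) k)
        (1 * (Pi.single j 1 : Fin n → ℝ) k) 0 :=
      ((hasDerivAt_id (0 : ℝ)).mul_const _).const_add _
    have hv : (Pi.single j 1 : Fin n → ℂ) k = ((1 * (Pi.single j 1 : Fin n → ℝ) k : ℝ) : ℂ) := by
      by_cases hk : k = j
      · subst hk; simp
      · simp [hk]
    rw [hv]
    exact h.ofReal_comp
  have hlin := HasDerivAt.fun_sum (u := Finset.univ) fun k _ => (hx k).mul_const (z k)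
  have hsq := HasDerivAt.fun_sum (u := Finset.univ) fun k _ => (hx k).fun_pow 2
  have h := ((((hlin.const_mul (2 * (Real.sqrt 2 : ℂ))).const_add
    (-(∑ k, z k ^ 2))).sub hsq).div_const (2 * (t : ℂ))).cexp
  refine HasDerivAt.congr_deriv (f := fun s : ℝ =>
    segalBargmannKernel t z (x + s • (Pi.single j 1 : Fin n → ℝ))) h ?_
  have hz : ∑ k, (Pi.single j 1 : Fin n → ℂ) k * z k = z j := by simp [Pi.single_apply]
  have hs : ∑ k, (x k : ℂ) * (Pi.single j 1 : Fin n → ℂ) k = x j := by simp [Pi.single_apply]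
  simp only [Pi.sub_apply, zero_smul, add_zero, segalBargmannKernel, Nat.cast_ofNat,
    Nat.add_one_sub_one, pow_one, mul_assoc, ← Finset.mul_sum, hz, hs]
  field_simp

theorem integrable_segalBargmannKernel_mul {n : ℕ} {t : ℝ} (ht : 0 < t) (z : Fin n → ℂ)
    {g : (Fin n → ℝ) → ℂ} (hg : Integrable g) :
    Integrable fun x => segalBargmannKernel t z x * g x :=
  hg.bdd_mul (continuous_segalBargmannKernel t z).aestronglyMeasurable
    (.of_forall (norm_segalBargmannKernel_le ht z))

theorem SchwartzMap.integrable_coord_mul {n : ℕ} (f : SchwartzMap (Fin n → ℝ) ℂ) (j : Fin n) :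
    Integrable fun x : Fin n → ℝ => (x j : ℂ) * f x := by
  refine (f.integrable_pow_mul volume 1).mono' ?_ (.of_forall fun x => ?_)
  · exact (Continuous.mul (by fun_prop) f.continuous).aestronglyMeasurable
  · rw [norm_mul, pow_one, Complex.norm_real]
    gcongr
    exact norm_le_pi_norm x j

theorem SchwartzMap.integrable_fderiv_apply {n : ℕ} (f : SchwartzMap (Fin n → ℝ) ℂ)
    (v : Fin n → ℝ) : Integrable fun x => fderiv ℝ f x v :=
  (SchwartzMap.fderivCLM ℝ _ _ f).integrable.apply_continuousLinearMap v

/-- Integration by parts against the Segal–Bargmann kernel. -/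
theorem integral_segalBargmannKernel_mul_fderiv {n : ℕ} {t : ℝ} (ht : 0 < t)
    (f : SchwartzMap (Fin n → ℝ) ℂ) (j : Fin n) (z : Fin n → ℂ) :
    ∫ x, segalBargmannKernel t z x * fderiv ℝ f x (Pi.single j 1) =
      -∫ x, segalBargmannKernel t z x * (((Real.sqrt 2 : ℂ) * z j - x j) / t) * f x := by
  refine integral_bilinear_hasLineDerivAt_right_eq_neg_left_of_integrable
    (B := ContinuousLinearMap.mul ℝ ℂ) ?_ ?_ ?_
    (fun x _ => hasLineDerivAt_segalBargmannKernel ht z j x)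
    (fun x _ => (f.differentiableAt (x := x)).hasFDerivAt.hasLineDerivAt _)
  · have h := integrable_segalBargmannKernel_mul ht z
      (((f.integrable.const_mul ((Real.sqrt 2 : ℂ) * z j)).sub
        (f.integrable_coord_mul j)).div_const (t : ℂ))
    refine h.congr (.of_forall fun x => ?_)
    simp only [Pi.sub_apply, ContinuousLinearMap.mul_apply']
    ring
  · exact integrable_segalBargmannKernel_mul ht z (f.integrable_fderiv_apply _)
  · exact integrable_segalBargmannKernel_mul ht z f.integrable

/-- The Segal–Bargmann transform intertwines the creation operator
`A_j* = 2^{-1/2}(x_j - t ∂_{x_j})` with multiplication by `z_j`: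
`W_t(A_j* f)(z) = z_j (W_t f)(z)` for every Schwartz function `f`. -/
theorem segalBargmann_creation
    (n : ℕ) (hn : 1 ≤ n) (t : ℝ) (ht : 0 < t)
    (f : SchwartzMap (Fin n → ℝ) ℂ) (j : Fin n) (z : Fin n → ℂ) :
    segalBargmann n t (fun x =>
        (((2 : ℝ) ^ (-(1 : ℝ) / 2) : ℝ) : ℂ) *
          ((x j : ℂ) * f x - (t : ℂ) * fderiv ℝ (⇑f) x (Pi.single j 1))) z
      = z j * segalBargmann n t (⇑f) z := by
  have ht' : (t : ℂ) ≠ 0 := by exact_mod_cast ht.ne'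
  have hc : (((2 : ℝ) ^ (-(1 : ℝ) / 2) : ℝ) : ℂ) * (Real.sqrt 2 : ℂ) = 1 := by
    rw [← Complex.ofReal_mul, Real.sqrt_eq_rpow, ← Real.rpow_add two_pos]
    norm_num
  have hxf := integrable_segalBargmannKernel_mul ht z (f.integrable_coord_mul j)
  have hf := integrable_segalBargmannKernel_mul ht z f.integrable
  have hdf := integrable_segalBargmannKernel_mul ht z
    (f.integrable_fderiv_apply (Pi.single j 1))
  have hparts : (t : ℂ) * ∫ x, segalBargmannKernel t z x * fderiv ℝ f x (Pi.single j 1) =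
      (∫ x, segalBargmannKernel t z x * ((x j : ℂ) * f x)) -
        (Real.sqrt 2 : ℂ) * z j * ∫ x, segalBargmannKernel t z x * f x := by
    rw [integral_segalBargmannKernel_mul_fderiv ht, mul_neg, ← integral_const_mul,
      ← integral_const_mul, ← integral_sub hxf (hf.const_mul _), ← integral_neg]
    congr 1 with x
    field_simp
    ring
  have hsplit : ∫ x, segalBargmannKernel t z x * ((((2 : ℝ) ^ (-(1 : ℝ) / 2) : ℝ) : ℂ) *
      ((x j : ℂ) * f x - (t : ℂ) * fderiv ℝ f x (Pi.single j 1))) =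
      (((2 : ℝ) ^ (-(1 : ℝ) / 2) : ℝ) : ℂ) *
        ((∫ x, segalBargmannKernel t z x * ((x j : ℂ) * f x)) -
          (t : ℂ) * ∫ x, segalBargmannKernel t z x * fderiv ℝ f x (Pi.single j 1)) := by
    rw [← integral_const_mul, ← integral_sub hxf (hdf.const_mul _), ← integral_const_mul]
    congr 1 with x
    ring
  rw [segalBargmann_eq_integral_kernel, segalBargmann_eq_integral_kernel, hsplit, hparts]
  linear_combination (((Real.pi * t) ^ (-(n : ℝ) / 4) : ℝ) : ℂ) * z j *
    (∫ x, segalBargmannKernel t z x * f x) * hc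
end

section
/- For every t > 0 and every multiindex α ∈ ℕⁿ, the Segal–Bargmann transform sends the α-th Hermite function to the normalized monomial: W_t h_α = u_α, where u_α(z) := (t^{|α|} α!)^{−1/2} z^α. In particular, since the Hermite functions {h_α} form an orthonormal basis of L²(ℝⁿ), W_t carries this orthonormal basis to the orthonormal basis {u_α} of the Fock space F_t. -/
open MeasureTheory Complex

/-- The creation operator `A_j* = 2^{-1/2}(x_j - t ∂_{x_j})`. -/
noncomputable def creation (n : ℕ) (t : ℝ) (j : Fin n)
    (f : (Fin n → ℝ) → ℂ) : (Fin n → ℝ) → ℂ :=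
  fun x => (((2 : ℝ) ^ (-(1 : ℝ) / 2) : ℝ) : ℂ) *
    ((x j : ℂ) * f x - (t : ℂ) * fderiv ℝ f x (Pi.single j 1))

/-- The iterated creation operator `(A*)^α = ∏_j (A_j*)^{α_j}` (the `A_j*` commute). -/
noncomputable def creationPow (n : ℕ) (t : ℝ) (α : Fin n → ℕ)
    (f : (Fin n → ℝ) → ℂ) : (Fin n → ℝ) → ℂ :=
  (List.finRange n).foldr (fun j g => (creation n t j)^[α j] g) f

/-- The Gaussian ground state `h_0(x) = (πt)^{-n/4} e^{-x²/(2t)}`. -/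
noncomputable def groundState (n : ℕ) (t : ℝ) (x : Fin n → ℝ) : ℂ :=
  (((Real.pi * t) ^ (-(n : ℝ) / 4) : ℝ) : ℂ) *
    Complex.exp (-(∑ k, (x k : ℂ) ^ 2) / (2 * (t : ℂ)))

/-- The Hermite function `h_α = (t^{|α|} α!)^{-1/2} (A*)^α h_0`. -/
noncomputable def hermiteFun (n : ℕ) (t : ℝ) (α : Fin n → ℕ)
    (x : Fin n → ℝ) : ℂ :=
  (((t ^ (∑ k, α k) * ∏ k, (Nat.factorial (α k) : ℝ)) ^ (-(1 : ℝ) / 2) : ℝ) : ℂ) *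
    creationPow n t α (groundState n t) x

namespace SegalBargmann

variable {n : ℕ}

/-- The Gaussian `exp (-b ∑ xᵢ² + ∑ cᵢ xᵢ)` on `ℝⁿ`. -/
noncomputable def gaussian (b : ℂ) (c : Fin n → ℂ) (x : Fin n → ℝ) : ℂ :=
  cexp (-b * ∑ i, (x i : ℂ) ^ 2 + ∑ i, c i * (x i : ℂ))

/-- Evaluation of a complex polynomial at a real point. -/
noncomputable def evalReal (p : MvPolynomial (Fin n) ℂ) (x : Fin n → ℝ) : ℂ :=
  MvPolynomial.eval (fun i => (x i : ℂ)) p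

lemma continuous_gaussian (b : ℂ) (c : Fin n → ℂ) : Continuous (gaussian b c) := by
  unfold gaussian; fun_prop

lemma differentiable_gaussian (b : ℂ) (c : Fin n → ℂ) : Differentiable ℝ (gaussian b c) := by
  have h (i : Fin n) : Differentiable ℝ fun x : Fin n → ℝ => (x i : ℂ) :=
    Complex.ofRealCLM.differentiable.comp (differentiable_apply i)
  unfold gaussian
  fun_prop

lemma hasFDerivAt_coord (i : Fin n) (x : Fin n → ℝ) :
    HasFDerivAt (fun x : Fin n → ℝ => (x i : ℂ))
      (Complex.ofRealCLM.comp (ContinuousLinearMap.proj (R := ℝ) i)) x :=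
  Complex.ofRealCLM.hasFDerivAt.comp x (hasFDerivAt_apply i x)

lemma fderiv_gaussian (b : ℂ) (c : Fin n → ℂ) (x : Fin n → ℝ) (j : Fin n) :
    fderiv ℝ (gaussian b c) x (Pi.single j 1) = (c j - 2 * b * x j) * gaussian b c x := by
  have h1 := HasFDerivAt.fun_sum (u := Finset.univ) fun i _ => (hasFDerivAt_coord i x).pow 2
  have h2 := HasFDerivAt.fun_sum (u := Finset.univ)
    fun i _ => (hasFDerivAt_coord i x).const_mul (c i)
  have h := ((h1.const_mul (-b)).add h2).cexp
  have h' : HasFDerivAt (gaussian b c) _ x := h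
  rw [h'.fderiv]
  simp [Pi.single_apply, gaussian, apply_ite (Complex.ofReal)]
  ring

lemma evalReal_C (a : ℂ) (x : Fin n → ℝ) : evalReal (MvPolynomial.C a) x = a := by
  simp [evalReal]

lemma evalReal_X (i : Fin n) (x : Fin n → ℝ) : evalReal (MvPolynomial.X i) x = x i := by
  simp [evalReal]

lemma evalReal_add (p q : MvPolynomial (Fin n) ℂ) (x : Fin n → ℝ) :
    evalReal (p + q) x = evalReal p x + evalReal q x := by
  simp [evalReal]

lemma evalReal_sub (p q : MvPolynomial (Fin n) ℂ) (x : Fin n → ℝ) :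
    evalReal (p - q) x = evalReal p x - evalReal q x := by
  simp [evalReal]

lemma evalReal_mul (p q : MvPolynomial (Fin n) ℂ) (x : Fin n → ℝ) :
    evalReal (p * q) x = evalReal p x * evalReal q x := by
  simp [evalReal]

lemma differentiable_evalReal (p : MvPolynomial (Fin n) ℂ) : Differentiable ℝ (evalReal p) := by
  induction p using MvPolynomial.induction_on with
  | C a => simpa only [funext (evalReal_C a)] using differentiable_const a
  | add p q hp hq => simpa only [funext (evalReal_add p q)] using hp.fun_add hq
  | mul_X p i hp =>
    simp only [funext (evalReal_mul p _), evalReal_X]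
    exact hp.fun_mul fun x => (hasFDerivAt_coord i x).differentiableAt

lemma fderiv_evalReal (p : MvPolynomial (Fin n) ℂ) (x : Fin n → ℝ) (j : Fin n) :
    fderiv ℝ (evalReal p) x (Pi.single j 1) = evalReal (MvPolynomial.pderiv j p) x := by
  induction p using MvPolynomial.induction_on with
  | C a => simp [funext (evalReal_C a), evalReal]
  | add p q hp hq =>
    rw [funext (evalReal_add p q), fderiv_fun_add (differentiable_evalReal p x)
      (differentiable_evalReal q x), map_add, evalReal_add, ← hp, ← hq]
    rfl
  | mul_X p i hp =>
    simp only [funext (evalReal_mul p _), evalReal_X]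
    rw [((differentiable_evalReal p x).hasFDerivAt.fun_mul (hasFDerivAt_coord i x)).fderiv]
    simp [Derivation.leibniz, evalReal_add, evalReal_mul, evalReal_X, hp, Pi.single_apply,
      MvPolynomial.pderiv_X]
    split_ifs <;> simp [evalReal]

/-- A polynomial times a Gaussian is integrable. -/
lemma integrable_evalReal_mul_gaussian {b : ℂ} (hb : 0 < b.re) (p : MvPolynomial (Fin n) ℂ)
    (c : Fin n → ℂ) : Integrable fun x => evalReal p x * gaussian b c x := by
  induction p using MvPolynomial.induction_on generalizing c with
  | C a =>
    simp only [evalReal_C]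
    exact (GaussianFourier.integrable_cexp_neg_mul_sum_add hb c).const_mul a
  | add p q hp hq =>
    simp only [evalReal_add, add_mul]
    exact (hp c).add (hq c)
  | mul_X p i hp =>
    have key (s : ℂ) (x : Fin n → ℝ) :
        gaussian b (c + Pi.single i s) x = gaussian b c x * cexp (s * x i) := by
      simp [gaussian, ← Complex.exp_add, add_mul, Finset.sum_add_distrib, Pi.single_apply,
        add_assoc]
    refine ((hp (c + Pi.single i 1)).norm.add (hp (c + Pi.single i (-1))).norm).mono' ?_ ?_
    · exact ((differentiable_evalReal _).continuous.mul
        (continuous_gaussian b c)).aestronglyMeasurable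
    · refine Filter.Eventually.of_forall fun x => ?_
      have hx : |x i| ≤ Real.exp (x i) + Real.exp (-x i) := by
        have h1 := Real.add_one_le_exp (x i)
        have h2 := Real.add_one_le_exp (-x i)
        have h3 := Real.exp_pos (x i)
        have h4 := Real.exp_pos (-x i)
        rcases abs_cases (x i) with h | h <;> linarith
      simp only [Pi.add_apply, key, evalReal_mul, evalReal_X, norm_mul, Complex.norm_exp,
        Complex.norm_real, Real.norm_eq_abs]
      have := mul_le_mul_of_nonneg_left hx
        (mul_nonneg (norm_nonneg (evalReal p x)) (norm_nonneg (gaussian b c x)))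
      simp
      linarith

/-- Integration by parts of a polynomial against a Gaussian. -/
lemma integral_pderiv_mul_gaussian {b : ℂ} (hb : 0 < b.re) (p : MvPolynomial (Fin n) ℂ)
    (c : Fin n → ℂ) (j : Fin n) :
    ∫ x, evalReal (2 * MvPolynomial.C b * MvPolynomial.X j * p - MvPolynomial.pderiv j p) x
        * gaussian b c x = c j * ∫ x, evalReal p x * gaussian b c x := by
  have e1 (x : Fin n → ℝ) : evalReal p x * fderiv ℝ (gaussian b c) x (Pi.single j 1) =
      c j * (evalReal p x * gaussian b c x) -
        evalReal (2 * MvPolynomial.C b * MvPolynomial.X j * p) x * gaussian b c x := by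
    rw [fderiv_gaussian]
    simp [evalReal]
    ring
  have i0 := (integrable_evalReal_mul_gaussian hb p c).const_mul (c j)
  have i1 := integrable_evalReal_mul_gaussian hb
    (2 * MvPolynomial.C b * MvPolynomial.X j * p) c
  have i2 := integrable_evalReal_mul_gaussian hb (MvPolynomial.pderiv j p) c
  have ibp := integral_mul_fderiv_eq_neg_fderiv_mul_of_integrable (μ := volume)
    (f := evalReal p) (g := gaussian b c) (v := Pi.single j 1)
    (by simpa only [fderiv_evalReal] using i2) (by simp only [e1]; exact i0.sub i1)
    (integrable_evalReal_mul_gaussian hb p c) (fun x _ => differentiable_evalReal p x)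
    (fun x _ => differentiable_gaussian b c x)
  simp only [e1, fderiv_evalReal] at ibp
  rw [integral_sub i0 i1, integral_const_mul] at ibp
  simp only [evalReal_sub _ (MvPolynomial.pderiv j p), sub_mul]
  rw [integral_sub i1 i2]
  linear_combination -ibp

/-- The polynomial `q` with `A_j* (p h₀) = q h₀`. -/
noncomputable def creationPoly (t : ℝ) (j : Fin n) (p : MvPolynomial (Fin n) ℂ) :
    MvPolynomial (Fin n) ℂ :=
  MvPolynomial.C ((((2 : ℝ) ^ (-(1 : ℝ) / 2) : ℝ) : ℂ) * t) *
    (2 * MvPolynomial.C (t : ℂ)⁻¹ * MvPolynomial.X j * p - MvPolynomial.pderiv j p)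

lemma groundState_eq_gaussian (t : ℝ) (x : Fin n → ℝ) :
    groundState n t x =
      (((Real.pi * t) ^ (-(n : ℝ) / 4) : ℝ) : ℂ) * gaussian (2 * t : ℂ)⁻¹ 0 x := by
  simp only [groundState, gaussian, Pi.zero_apply, zero_mul, Finset.sum_const_zero, add_zero]
  congr 2
  ring

lemma creation_evalReal_mul_groundState {t : ℝ} (ht : t ≠ 0) (j : Fin n)
    (p : MvPolynomial (Fin n) ℂ) :
    creation n t j (fun x => evalReal p x * groundState n t x) =
      fun x => evalReal (creationPoly t j p) x * groundState n t x := by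
  funext x
  have ht' : (t : ℂ) ≠ 0 := by exact_mod_cast ht
  simp only [creation, groundState_eq_gaussian]
  rw [((differentiable_evalReal p x).hasFDerivAt.fun_mul
    ((differentiable_gaussian (2 * t : ℂ)⁻¹ 0 x).hasFDerivAt.const_mul
      (((Real.pi * t) ^ (-(n : ℝ) / 4) : ℝ) : ℂ))).fderiv]
  simp only [add_apply, smul_apply, smul_eq_mul,
    fderiv_evalReal, fderiv_gaussian, Pi.zero_apply, creationPoly]
  simp only [evalReal, map_mul, map_sub, MvPolynomial.eval_C, MvPolynomial.eval_X, map_ofNat]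
  field_simp
  ring

lemma integral_creationPoly {t : ℝ} (ht : 0 < t) (j : Fin n) (p : MvPolynomial (Fin n) ℂ)
    (z : Fin n → ℂ) :
    ∫ x, evalReal (creationPoly t j p) x *
        gaussian (t : ℂ)⁻¹ (fun i => (Real.sqrt 2 : ℂ) * z i / t) x =
      z j * ∫ x, evalReal p x *
        gaussian (t : ℂ)⁻¹ (fun i => (Real.sqrt 2 : ℂ) * z i / t) x := by
  have hb : 0 < ((t : ℂ)⁻¹).re := by
    rw [← Complex.ofReal_inv, Complex.ofReal_re]
    positivity
  have ht' : (t : ℂ) ≠ 0 := by exact_mod_cast ht.ne'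
  have h2 : (((2 : ℝ) ^ (-(1 : ℝ) / 2) : ℝ) : ℂ) * (Real.sqrt 2 : ℂ) = 1 := by
    rw [← Complex.ofReal_mul, Real.sqrt_eq_rpow, ← Real.rpow_add two_pos]
    norm_num
  simp only [creationPoly, evalReal_mul (MvPolynomial.C _) (_ - _), evalReal_C]
  simp only [mul_assoc _ (evalReal _ _)]
  rw [integral_const_mul, integral_pderiv_mul_gaussian hb]
  generalize ∫ x, evalReal p x *
    gaussian (t : ℂ)⁻¹ (fun i => (Real.sqrt 2 : ℂ) * z i / t) x = I
  generalize (((2 : ℝ) ^ (-(1 : ℝ) / 2) : ℝ) : ℂ) = a at h2 ⊢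
  field_simp
  linear_combination I * z j * h2

lemma iterate_creation_evalReal_mul_groundState {t : ℝ} (ht : t ≠ 0) (j : Fin n) (m : ℕ)
    (p : MvPolynomial (Fin n) ℂ) :
    (creation n t j)^[m] (fun x => evalReal p x * groundState n t x) =
      fun x => evalReal ((creationPoly t j)^[m] p) x * groundState n t x := by
  induction m with
  | zero => rfl
  | succ m ih =>
    rw [Function.iterate_succ_apply', ih, creation_evalReal_mul_groundState ht,
      Function.iterate_succ_apply']

lemma integral_iterate_creationPoly {t : ℝ} (ht : 0 < t) (j : Fin n) (m : ℕ)
    (p : MvPolynomial (Fin n) ℂ) (z : Fin n → ℂ) :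
    ∫ x, evalReal ((creationPoly t j)^[m] p) x *
        gaussian (t : ℂ)⁻¹ (fun i => (Real.sqrt 2 : ℂ) * z i / t) x =
      z j ^ m * ∫ x, evalReal p x *
        gaussian (t : ℂ)⁻¹ (fun i => (Real.sqrt 2 : ℂ) * z i / t) x := by
  induction m with
  | zero => simp
  | succ m ih =>
    rw [Function.iterate_succ_apply', integral_creationPoly ht, ih]
    ring

lemma foldr_creation_groundState {t : ℝ} (ht : t ≠ 0) (α : Fin n → ℕ) (l : List (Fin n)) :
    l.foldr (fun j g => (creation n t j)^[α j] g) (groundState n t) =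
      fun x => evalReal (l.foldr (fun j p => (creationPoly t j)^[α j] p) 1) x *
        groundState n t x := by
  induction l with
  | nil => simp [evalReal]
  | cons j l ih =>
    rw [List.foldr_cons, ih, iterate_creation_evalReal_mul_groundState ht, List.foldr_cons]

lemma integral_foldr_creationPoly {t : ℝ} (ht : 0 < t) (α : Fin n → ℕ) (l : List (Fin n))
    (z : Fin n → ℂ) :
    ∫ x, evalReal (l.foldr (fun j p => (creationPoly t j)^[α j] p) 1) x *
        gaussian (t : ℂ)⁻¹ (fun i => (Real.sqrt 2 : ℂ) * z i / t) x =
      (l.map fun j => z j ^ α j).prod *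
        ∫ x, gaussian (t : ℂ)⁻¹ (fun i => (Real.sqrt 2 : ℂ) * z i / t) x := by
  induction l with
  | nil => simp [evalReal]
  | cons j l ih =>
    rw [List.foldr_cons, integral_iterate_creationPoly ht, ih, List.map_cons, List.prod_cons,
      mul_assoc]

/-- The integral of the Gaussian occurring in the transform of the ground state. -/
lemma integral_gaussian {t : ℝ} (ht : 0 < t) (z : Fin n → ℂ) :
    ∫ x, gaussian (t : ℂ)⁻¹ (fun i => (Real.sqrt 2 : ℂ) * z i / t) x =
      (((Real.pi * t) ^ ((n : ℝ) / 2) : ℝ) : ℂ) * cexp ((∑ k, z k ^ 2) / (2 * t)) := by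
  have hb : 0 < ((t : ℂ)⁻¹).re := by
    rw [← Complex.ofReal_inv, Complex.ofReal_re]
    positivity
  have ht' : (t : ℂ) ≠ 0 := by exact_mod_cast ht.ne'
  have h2 : (Real.sqrt 2 : ℂ) ^ 2 = 2 := by
    rw [← Complex.ofReal_pow, Real.sq_sqrt two_pos.le, Complex.ofReal_ofNat]
  unfold gaussian
  rw [GaussianFourier.integral_cexp_neg_mul_sum_add hb]
  congr 1
  · rw [Complex.ofReal_cpow (by positivity)]
    simp
  · congr 1
    simp only [div_pow, mul_pow, h2, ← Finset.sum_div, ← Finset.mul_sum]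
    field_simp
    ring

lemma kernel_mul_groundState {t : ℝ} (ht : t ≠ 0) (z : Fin n → ℂ) (x : Fin n → ℝ) :
    cexp ((-(∑ k, z k ^ 2) + 2 * (Real.sqrt 2 : ℂ) * (∑ k, (x k : ℂ) * z k)
        - ∑ k, (x k : ℂ) ^ 2) / (2 * (t : ℂ))) * groundState n t x =
      (((Real.pi * t) ^ (-(n : ℝ) / 4) : ℝ) : ℂ) * cexp (-(∑ k, z k ^ 2) / (2 * t)) *
        gaussian (t : ℂ)⁻¹ (fun i => (Real.sqrt 2 : ℂ) * z i / t) x := by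
  have ht' : (t : ℂ) ≠ 0 := by exact_mod_cast ht
  have hs : ∑ i, (Real.sqrt 2 : ℂ) * z i / t * (x i : ℂ) =
      (Real.sqrt 2 : ℂ) / t * ∑ i, (x i : ℂ) * z i := by
    rw [Finset.mul_sum]
    exact Finset.sum_congr rfl fun i _ => by ring
  rw [groundState, gaussian, hs, mul_left_comm, ← Complex.exp_add, mul_assoc _ (cexp _) (cexp _),
    ← Complex.exp_add]
  congr 2
  field_simp
  ring

end SegalBargmann

/-- The Segal–Bargmann transform sends the `α`-th Hermite function to the normalized
monomial `u_α(z) = (t^{|α|} α!)^{-1/2} z^α`. -/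
theorem segalBargmann_hermite
    (n : ℕ) (hn : 1 ≤ n) (t : ℝ) (ht : 0 < t) (α : Fin n → ℕ) (z : Fin n → ℂ) :
    segalBargmann n t (hermiteFun n t α) z
      = (((t ^ (∑ k, α k) * ∏ k, (Nat.factorial (α k) : ℝ)) ^ (-(1 : ℝ) / 2) : ℝ) : ℂ) *
          ∏ k, z k ^ α k := by
  have hc : (((Real.pi * t) ^ (-(n : ℝ) / 4) : ℝ) : ℂ) *
      (((Real.pi * t) ^ (-(n : ℝ) / 4) : ℝ) : ℂ) *
        (((Real.pi * t) ^ ((n : ℝ) / 2) : ℝ) : ℂ) = 1 := by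
    have hpos : 0 < Real.pi * t := by positivity
    rw [← Complex.ofReal_mul, ← Complex.ofReal_mul, ← Real.rpow_add hpos, ← Real.rpow_add hpos]
    ring_nf
    simp
  have he : cexp (-(∑ k, z k ^ 2) / (2 * t)) * cexp ((∑ k, z k ^ 2) / (2 * t)) = 1 := by
    rw [← Complex.exp_add, neg_div, neg_add_cancel, Complex.exp_zero]
  have hprod : ((List.finRange n).map fun j => z j ^ α j).prod = ∏ k, z k ^ α k := by
    rw [← List.ofFn_eq_map, List.prod_ofFn]
  set N : ℂ := (((t ^ (∑ k, α k) * ∏ k, (Nat.factorial (α k) : ℝ)) ^ (-(1 : ℝ) / 2) : ℝ) : ℂ)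
    with hN
  set q := (List.finRange n).foldr
    (fun j p => (SegalBargmann.creationPoly t j)^[α j] p) 1 with hq
  have hI := SegalBargmann.integral_foldr_creationPoly ht α (List.finRange n) z
  rw [← hq, hprod, SegalBargmann.integral_gaussian ht] at hI
  have hint (x : Fin n → ℝ) :
      cexp ((-(∑ k, z k ^ 2) + 2 * (Real.sqrt 2 : ℂ) * (∑ k, (x k : ℂ) * z k)
        - ∑ k, (x k : ℂ) ^ 2) / (2 * (t : ℂ))) * hermiteFun n t α x =
      N * (((Real.pi * t) ^ (-(n : ℝ) / 4) : ℝ) : ℂ) * cexp (-(∑ k, z k ^ 2) / (2 * t)) *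
        (SegalBargmann.evalReal q x * SegalBargmann.gaussian (t : ℂ)⁻¹
          (fun i => (Real.sqrt 2 : ℂ) * z i / t) x) := by
    rw [hermiteFun, creationPow, SegalBargmann.foldr_creation_groundState ht.ne', ← hN, ← hq]
    linear_combination N * SegalBargmann.evalReal q x *
      SegalBargmann.kernel_mul_groundState ht.ne' z x
  simp only [segalBargmann, hint]
  rw [integral_const_mul, hI]
  linear_combination N * (∏ k, z k ^ α k) * cexp (-(∑ k, z k ^ 2) / (2 * t)) *
    cexp ((∑ k, z k ^ 2) / (2 * t)) * hc + N * (∏ k, z k ^ α k) * he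
end

section
/- Let m ∈ ℕ and let w : [0,1] → ℝ be of class C^{m+1} with w^{(k)}(1) = 0 for all 0 ≤ k < m. Then lim_{N→∞} N^{m+1} ∫₀¹ w(s) s^{N−1} ds = (−1)^m w^{(m)}(1); equivalently, ∫₀¹ w(s) s^{N−1} ds ∼ (−1)^m w^{(m)}(1) / ∏_{k=0}^{m} (N+k) as N → ∞ (when w^{(m)}(1) ≠ 0). -/
open MeasureTheory intervalIntegral

/-- Integration by parts for the moments of a `C^1` function on `[0,1]`. -/
lemma natCast_mul_moment_eq {w : ℝ → ℝ} (hw : ContDiffOn ℝ 1 w (Set.Icc 0 1)) {N : ℕ}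
    (hN : 1 ≤ N) :
    (N : ℝ) * ∫ s in (0:ℝ)..1, w s * s ^ (N - 1) =
      w 1 - ∫ s in (0:ℝ)..1, derivWithin w (Set.Icc 0 1) s * s ^ N := by
  have hu : UniqueDiffOn ℝ (Set.Icc (0:ℝ) 1) := uniqueDiffOn_Icc one_pos
  have huIcc : Set.uIcc (0:ℝ) 1 = Set.Icc 0 1 := Set.uIcc_of_le zero_le_one
  have hc : ContinuousOn (derivWithin w (Set.Icc 0 1)) (Set.Icc 0 1) :=
    hw.continuousOn_derivWithin hu le_rfl
  have hparts := integral_mul_deriv_eq_deriv_mul_of_hasDerivWithinAt (a := (0:ℝ)) (b := 1)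
    (u := w) (u' := derivWithin w (Set.Icc 0 1)) (v := fun s => s ^ N)
    (v' := fun s => (N : ℝ) * s ^ (N - 1))
    (fun x hx => by
      rw [huIcc] at hx ⊢
      exact ((hw.differentiableOn one_ne_zero) x hx).hasDerivWithinAt)
    (fun x _ => (hasDerivAt_pow N x).hasDerivWithinAt)
    (ContinuousOn.intervalIntegrable (by rwa [huIcc]))
    (Continuous.intervalIntegrable (by fun_prop) _ _)
  simp only [one_pow, mul_one, zero_pow (by omega : N ≠ 0), mul_zero, sub_zero] at hparts
  rw [← hparts, ← intervalIntegral.integral_const_mul]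
  congr 1
  ext s
  ring

/-- The moments of a continuous function on `[0,1]` tend to zero. -/
lemma tendsto_moment_zero {f : ℝ → ℝ} (hf : ContinuousOn f (Set.Icc 0 1)) :
    Filter.Tendsto (fun N : ℕ => ∫ s in (0:ℝ)..1, f s * s ^ N) Filter.atTop (nhds 0) := by
  obtain ⟨C, hC⟩ := isCompact_Icc.exists_bound_of_continuousOn hf
  have hlim : Filter.Tendsto (fun N : ℕ => C * (1 / ((N : ℝ) + 1))) Filter.atTop (nhds 0) := by
    simpa using (tendsto_one_div_add_atTop_nhds_zero_nat (𝕜 := ℝ)).const_mul C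
  refine squeeze_zero_norm (fun N => ?_) hlim
  have hbound : ‖∫ s in (0:ℝ)..1, f s * s ^ N‖ ≤ ∫ s in (0:ℝ)..1, C * s ^ N := by
    refine intervalIntegral.norm_integral_le_of_norm_le zero_le_one ?_
      (Continuous.intervalIntegrable (by fun_prop) _ _)
    refine Filter.Eventually.of_forall fun s hs => ?_
    rw [norm_mul, Real.norm_of_nonneg (pow_nonneg hs.1.le N)]
    exact mul_le_mul_of_nonneg_right (hC s ⟨hs.1.le, hs.2⟩) (pow_nonneg hs.1.le N)
  simpa using hbound

/-- If `w` is `C^{m+1}` on `[0,1]` with `w^{(k)}(1) = 0` for all `k < m`, then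
`N^{m+1} ∫₀¹ w(s) s^{N-1} ds → (-1)^m w^{(m)}(1)` as `N → ∞`. -/
theorem moment_asymptotics
    (m : ℕ) (w : ℝ → ℝ)
    (hw : ContDiffOn ℝ (m + 1) w (Set.Icc 0 1))
    (hvanish : ∀ k < m, iteratedDerivWithin k w (Set.Icc 0 1) 1 = 0) :
    Filter.Tendsto
      (fun N : ℕ => (N : ℝ) ^ (m + 1) * ∫ s in (0:ℝ)..1, w s * s ^ (N - 1))
      Filter.atTop
      (nhds ((-1 : ℝ) ^ m * iteratedDerivWithin m w (Set.Icc 0 1) 1)) := by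
  have hu : UniqueDiffOn ℝ (Set.Icc (0:ℝ) 1) := uniqueDiffOn_Icc one_pos
  induction m generalizing w with
  | zero =>
    have hw1 : ContDiffOn ℝ 1 w (Set.Icc 0 1) := by simpa using hw
    have hlim := (tendsto_moment_zero (hw1.continuousOn_derivWithin hu le_rfl)).const_sub (w 1)
    simp only [sub_zero] at hlim
    simp only [pow_zero, one_mul, iteratedDerivWithin_zero, zero_add, pow_one]
    refine hlim.congr' ?_
    filter_upwards [Filter.eventually_ge_atTop 1] with N hN
    exact (natCast_mul_moment_eq hw1 hN).symm
  | succ m ih =>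
    have hw1 : ContDiffOn ℝ 1 w (Set.Icc 0 1) := hw.of_le (by simp)
    have hone : w 1 = 0 := by simpa using hvanish 0 m.succ_pos
    have hderiv := ih (derivWithin w (Set.Icc 0 1))
      (hw.derivWithin hu (by push_cast; exact le_rfl))
      (fun k hk => by
        rw [← iteratedDerivWithin_succ']
        exact hvanish (k + 1) (by omega))
    have hratio := (tendsto_natCast_div_add_atTop (𝕜 := ℝ) 1).pow (m + 1)
    have hlim := (hratio.mul (hderiv.comp (Filter.tendsto_add_atTop_nat 1))).neg
    rw [iteratedDerivWithin_succ']
    convert hlim.congr' ?_ using 2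
    · ring
    filter_upwards [Filter.eventually_ge_atTop 1] with N hN
    have hne : (N : ℝ) + 1 ≠ 0 := by positivity
    rw [pow_succ (N : ℝ) (m + 1), mul_assoc, natCast_mul_moment_eq hw1 hN, hone]
    simp only [Function.comp_apply, Nat.add_sub_cancel, Nat.cast_add, Nat.cast_one, div_pow]
    field_simp
    ring
end

section
/- Let w : [0,1] → ℝ be continuous with w ≥ 0 and w(1) > 0, and let r : [0,1] → ℝ be of class C¹ with r(1) = 0. Then lim_{N→∞} N · (∫₀¹ r(s) w(s) s^{N−1} ds) / (∫₀¹ w(s) s^{N−1} ds) = −r′(1). In particular, with N = 2n + 2|α|, the eigenvalues ⟨T_r v_α, v_α⟩ of the Toeplitz operator with radial symbol r on the unweighted Bergman space of the ball behave asymptotically like −r′(1)/(2|α|) as |α| → ∞. -/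
open MeasureTheory intervalIntegral

/-- For each `j`, the kernels `(m + 1)^(j + 1) (1 - s)^j s^m` concentrate at `s = 1` as `m → ∞`,
as soon as their total mass on `[0, 1]` tends to `1`. -/
lemma tendsto_integral_one_sub_pow_mul_pow_mul (j : ℕ) {g : ℝ → ℝ}
    (hg : ContinuousOn g (Set.Icc 0 1))
    (hmass : Filter.Tendsto
      (fun m : ℕ => ∫ s in (0:ℝ)..1, ((m:ℝ) + 1) ^ (j + 1) * (1 - s) ^ j * s ^ m)
      Filter.atTop (nhds 1)) :
    Filter.Tendsto
      (fun m : ℕ => ∫ s in (0:ℝ)..1, ((m:ℝ) + 1) ^ (j + 1) * (1 - s) ^ j * s ^ m * g s)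
      Filter.atTop (nhds (g 1)) := by
  simp only [intervalIntegral.integral_of_le zero_le_one] at hmass ⊢
  refine tendsto_setIntegral_peak_smul_of_integrableOn_of_tendsto (x₀ := (1:ℝ))
    measurableSet_Ioc measurableSet_Ioc subset_rfl self_mem_nhdsWithin (by simp) ?_ ?_ hmass ?_
    (hg.integrableOn_Icc.mono_set Set.Ioc_subset_Icc_self)
    ((hg 1 (by simp)).mono Set.Ioc_subset_Icc_self)
  · refine .of_forall fun m s hs => ?_
    have h0 : 0 ≤ s := hs.1.le
    have h1 : 0 ≤ 1 - s := sub_nonneg.2 hs.2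
    positivity
  · intro u hu h1u
    obtain ⟨δ, hδ, hball⟩ := Metric.isOpen_iff.1 hu 1 h1u
    obtain ⟨ρ, hρ0, hρ1, hρ⟩ : ∃ ρ : ℝ, 0 < ρ ∧ ρ < 1 ∧ 1 - δ ≤ ρ :=
      ⟨max (1 - δ) (1 / 2), by simp, by simp [hδ]; norm_num, le_max_left _ _⟩
    have hlim : Filter.Tendsto (fun m : ℕ => ((m:ℝ) + 1) ^ (j + 1) * ρ ^ m)
        Filter.atTop (nhds 0) := by
      have := ((Filter.tendsto_add_atTop_iff_nat 1).2
        (tendsto_pow_const_mul_const_pow_of_lt_one (j + 1) hρ0.le hρ1)).div_const ρ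
      rw [zero_div] at this
      refine this.congr fun m => ?_
      push_cast
      field_simp
      ring
    rw [Metric.tendstoUniformlyOn_iff]
    intro ε hε
    filter_upwards [hlim.eventually (gt_mem_nhds hε)] with m hm s hs
    have h0 : 0 ≤ s := hs.1.1.le
    have h1 : 0 ≤ 1 - s := sub_nonneg.2 hs.1.2
    have hsρ : s ≤ ρ := by
      by_contra! h
      refine hs.2 (hball ?_)
      rw [Metric.mem_ball, Real.dist_eq, abs_sub_comm, abs_of_nonneg h1]
      linarith
    rw [Pi.zero_apply, dist_zero_left, Real.norm_of_nonneg (by positivity)]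
    refine lt_of_le_of_lt ?_ hm
    gcongr
    exact mul_le_of_le_one_right (by positivity) (pow_le_one₀ h1 (by linarith))
  · exact .of_forall fun m => by fun_prop

/-- If `w ≥ 0` is continuous on `[0,1]` with `w(1) > 0` and `r` is `C¹` on `[0,1]`
with `r(1) = 0`, then
`N (∫₀¹ r w s^{N-1}) / (∫₀¹ w s^{N-1}) → -r′(1)` as `N → ∞`.
(These quotients are the eigenvalues of the Toeplitz operator with radial symbol `r`
on the Bergman space of the ball, with `N = 2n + 2|α|`.) -/
theorem radial_toeplitz_eigenvalue_asymptotics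
    (w r : ℝ → ℝ)
    (hw : ContinuousOn w (Set.Icc 0 1)) (hwpos : ∀ s ∈ Set.Icc (0:ℝ) 1, 0 ≤ w s)
    (hw1 : 0 < w 1)
    (hr : ContDiffOn ℝ 1 r (Set.Icc 0 1)) (hr1 : r 1 = 0) :
    Filter.Tendsto
      (fun N : ℕ => (N : ℝ) *
        ((∫ s in (0:ℝ)..1, r s * w s * s ^ (N - 1)) /
          (∫ s in (0:ℝ)..1, w s * s ^ (N - 1))))
      Filter.atTop
      (nhds (-(derivWithin r (Set.Icc 0 1) 1))) := by
  have hratio : Filter.Tendsto (fun m : ℕ => ((m:ℝ) + 1) / ((m:ℝ) + 1 + 1))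
      Filter.atTop (nhds 1) := by
    simpa using (Filter.tendsto_add_atTop_iff_nat 1).2 (tendsto_natCast_div_add_atTop (1:ℝ))
  set q : ℝ → ℝ := Function.update (slope r 1) 1 (derivWithin r (Set.Icc 0 1) 1) with hq_def
  have hq1 : q 1 = derivWithin r (Set.Icc 0 1) 1 := Function.update_self ..
  have hq_mul (s : ℝ) : (1 - s) * q s = -r s := by
    rcases eq_or_ne s 1 with rfl | hs
    · simp [hr1]
    · have : s - 1 ≠ 0 := sub_ne_zero.2 hs
      rw [hq_def, Function.update_of_ne hs, slope_def_field, hr1]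
      field_simp
      ring
  have hq : ContinuousOn q (Set.Icc 0 1) := by
    intro s hs
    rcases eq_or_ne s 1 with rfl | hs1
    · exact continuousWithinAt_update_same.2 (hasDerivWithinAt_iff_tendsto_slope.1
        (hr.differentiableOn one_ne_zero 1 hs).hasDerivWithinAt)
    · refine (continuousWithinAt_update_of_ne hs1).2 ?_
      simp only [slope_fun_def_field]
      exact ((hr.continuousOn s hs).sub continuousWithinAt_const).div
        (continuousWithinAt_id.sub continuousWithinAt_const) (sub_ne_zero.2 hs1)
  have hden := tendsto_integral_one_sub_pow_mul_pow_mul 0 hw <| by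
    refine tendsto_const_nhds.congr fun m => ?_
    have : (m:ℝ) + 1 ≠ 0 := by positivity
    simp [this]
  have hnum := tendsto_integral_one_sub_pow_mul_pow_mul 1 (hq.mul hw) <| by
    refine hratio.congr fun m => ?_
    have h1 : (m:ℝ) + 1 ≠ 0 := by positivity
    have h2 : (m:ℝ) + 1 + 1 ≠ 0 := by positivity
    have (s : ℝ) : ((m:ℝ) + 1) ^ (1 + 1) * (1 - s) ^ 1 * s ^ m
        = ((m:ℝ) + 1) ^ 2 * (s ^ m - s ^ (m + 1)) := by ring
    simp only [this]
    rw [intervalIntegral.integral_const_mul, intervalIntegral.integral_sub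
      (by simp) (by simp), integral_pow, integral_pow]
    push_cast
    simp
    field_simp
    ring
  have hlim := (hnum.div hden hw1.ne').neg
  rw [Pi.mul_apply, mul_div_cancel_right₀ _ hw1.ne', hq1] at hlim
  rw [← Filter.tendsto_add_atTop_iff_nat 1]
  refine hlim.congr fun m => ?_
  have h1 : (m:ℝ) + 1 ≠ 0 := by positivity
  have hN (s : ℝ) : ((m:ℝ) + 1) ^ (1 + 1) * (1 - s) ^ 1 * s ^ m * (q * w) s
      = -((m:ℝ) + 1) ^ 2 * (r s * w s * s ^ m) := by
    rw [Pi.mul_apply]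
    linear_combination ((m:ℝ) + 1) ^ 2 * s ^ m * w s * hq_mul s
  have hD (s : ℝ) : ((m:ℝ) + 1) ^ (0 + 1) * (1 - s) ^ 0 * s ^ m * w s
      = ((m:ℝ) + 1) * (w s * s ^ m) := by ring
  simp only [Pi.div_apply, hN, hD, intervalIntegral.integral_const_mul, Nat.add_sub_cancel]
  push_cast
  rw [mul_div_mul_comm]
  field_simp
end
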